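/- Let σ = τ_{r₁(n),r₂(n)} and η = τ_{r₃(m),r₄(m)} be horizontal class transpositions, where 0 ≤ r₁ < r₂ < n and 0 ≤ r₃ < r₄ < m. Then (σ · η)¹² is the identity permutation of ℤ. -/

import Mathlib

/-- The permutation of `ℤ` sending `r₁ + m₁ k ↦ r₂ + m₂ k` and `r₂ + m₂ k ↦ r₁ + m₁ k`
for every `k ∈ ℤ`, and fixing every other integer (the class transposition
`τ_{r₁(m₁), r₂(m₂)}`). -/
def IsClassTransposition (τ : Equiv.Perm ℤ) (r₁ m₁ r₂ m₂ : ℤ) : Prop :=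
  (∀ k : ℤ, τ (r₁ + m₁ * k) = r₂ + m₂ * k) ∧
  (∀ k : ℤ, τ (r₂ + m₂ * k) = r₁ + m₁ * k) ∧
  (∀ n : ℤ, (∀ k : ℤ, n ≠ r₁ + m₁ * k) → (∀ k : ℤ, n ≠ r₂ + m₂ * k) → τ n = n)

namespace Equiv.Perm

variable {α : Type*} {s t : Equiv.Perm α}

theorem mul_pow_apply_left_iff (hs : ∀ x, s (s x) = x) (ht : ∀ x, t (t x) = x) (k : ℕ) (x : α) :
    ((s * t) ^ k) (s x) = s x ↔ ((s * t) ^ k) x = x := by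
  have hs' : s⁻¹ = s := inv_eq_of_mul_eq_one_right (Equiv.ext hs)
  have ht' : t⁻¹ = t := inv_eq_of_mul_eq_one_right (Equiv.ext ht)
  have hc : s * (s * t) ^ k * s⁻¹ = ((s * t) ^ k)⁻¹ := by
    rw [← conj_pow, ← inv_pow, mul_inv_rev, hs', ht']
    congr 1
    ext x
    simp [hs]
  have hx : s (((s * t) ^ k) x) = ((s * t) ^ k)⁻¹ (s x) := by
    rw [← hc]
    simp
  rw [← s.injective.eq_iff (a := ((s * t) ^ k) x), hx, Equiv.Perm.inv_eq_iff_eq, eq_comm]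

theorem mul_pow_apply_right_iff (hs : ∀ x, s (s x) = x) (ht : ∀ x, t (t x) = x) (k : ℕ) (x : α) :
    ((s * t) ^ k) (t x) = t x ↔ ((s * t) ^ k) x = x := by
  rw [← mul_pow_apply_left_iff hs ht k (t x)]
  have h : s (t x) = (s * t) x := rfl
  rw [h, ← Equiv.Perm.mul_apply, ← pow_succ, pow_succ', Equiv.Perm.mul_apply,
    (s * t).injective.eq_iff]

/-- If every alternating path of four edges `s, t, s, t` starts at a point fixed by `(s * t) ^ 12`,
then so does every point: the remaining orbits of the two involutions are paths with at most
four vertices. -/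
theorem mul_pow_twelve_eq_one (hs : ∀ x, s (s x) = x) (ht : ∀ x, t (t x) = x)
    (H : ∀ y, s y ≠ y → t (s y) ≠ s y → s (t (s y)) ≠ t (s y) →
      t (s (t (s y))) ≠ s (t (s y)) → ((s * t) ^ 12) y = y) :
    (s * t) ^ 12 = 1 := by
  have hL := mul_pow_apply_left_iff hs ht 12
  have hR := mul_pow_apply_right_iff hs ht 12
  ext x
  rw [Equiv.Perm.one_apply]
  by_cases l1 : s x = x
  · by_cases r1 : t x = x
    · simp [pow_succ, *]
    by_cases r2 : s (t x) = t x
    · simp [pow_succ, *]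
    by_cases r3 : t (s (t x)) = s (t x)
    · simp [pow_succ, *]
    by_cases r4 : s (t (s (t x))) = t (s (t x))
    · simp [pow_succ, *]
    have := H (s (t (s (t x))))
    rw [hL, hR, hL, hR] at this
    simp only [hs, ht] at this
    exact this (Ne.symm r4) (Ne.symm r3) (Ne.symm r2) (Ne.symm r1)
  by_cases r1 : t x = x
  · by_cases l2 : t (s x) = s x
    · simp [pow_succ, *]
    by_cases l3 : s (t (s x)) = t (s x)
    · simp [pow_succ, *]
    by_cases l4 : t (s (t (s x))) = s (t (s x))
    · simp [pow_succ, *]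
    exact H x l1 l2 l3 l4
  by_cases l2 : t (s x) = s x
  · by_cases r2 : s (t x) = t x
    · simp [pow_succ, *]
    by_cases r3 : t (s (t x)) = s (t x)
    · simp [pow_succ, *]
    have := H (s x)
    rw [hL] at this
    simp only [hs] at this
    exact this (Ne.symm l1) r1 r2 r3
  by_cases r2 : s (t x) = t x
  · by_cases l3 : s (t (s x)) = t (s x)
    · simp [pow_succ, *]
    have := H (s (t (s x)))
    rw [hL, hR, hL] at this
    simp only [hs, ht] at this
    exact this (Ne.symm l3) (Ne.symm l2) (Ne.symm l1) r1
  have := H (s (t x))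
  rw [hL, hR] at this
  simp only [hs, ht] at this
  exact this (Ne.symm r2) (Ne.symm r1) l1 l2

end Equiv.Perm

namespace IsClassTransposition

variable {τ : Equiv.Perm ℤ} {p q n : ℤ}

theorem apply_of_dvd_left (h : IsClassTransposition τ p n q n) {x : ℤ} (hx : n ∣ x - p) :
    τ x = x + (q - p) := by
  obtain ⟨k, hk⟩ := hx
  obtain rfl : x = p + n * k := by linarith
  rw [h.1]
  ring

theorem apply_of_dvd_right (h : IsClassTransposition τ p n q n) {x : ℤ} (hx : n ∣ x - q) :
    τ x = x - (q - p) := by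
  obtain ⟨k, hk⟩ := hx
  obtain rfl : x = q + n * k := by linarith
  rw [h.2.1]
  ring

theorem apply_of_not_dvd (h : IsClassTransposition τ p n q n) {x : ℤ} (hp : ¬ n ∣ x - p)
    (hq : ¬ n ∣ x - q) : τ x = x :=
  h.2.2 x (fun k hk => hp ⟨k, by linarith⟩) (fun k hk => hq ⟨k, by linarith⟩)

theorem dvd_of_apply_ne (h : IsClassTransposition τ p n q n) {x : ℤ} (hx : τ x ≠ x) :
    n ∣ x - p ∨ n ∣ x - q := by
  by_contra! hc
  exact hx (h.apply_of_not_dvd hc.1 hc.2)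

theorem apply_apply (h : IsClassTransposition τ p n q n) (x : ℤ) : τ (τ x) = x := by
  by_cases hp : n ∣ x - p
  · rw [h.apply_of_dvd_left hp, h.apply_of_dvd_right (by convert hp using 1; ring)]
    ring
  by_cases hq : n ∣ x - q
  · rw [h.apply_of_dvd_right hq, h.apply_of_dvd_left (by convert hq using 1; ring)]
    ring
  simp only [h.apply_of_not_dvd hp hq]

end IsClassTransposition

theorem Int.eq_of_dvd_of_pos_of_lt_two_mul {m c : ℤ} (h : m ∣ c) (h0 : 0 < c) (h1 : c < 2 * m) :
    c = m := by
  obtain ⟨k, rfl⟩ := h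
  have hm : 0 < m := by linarith
  have hk0 : 0 < k := by nlinarith
  have hk1 : k < 2 := by nlinarith
  obtain rfl : k = 1 := by omega
  ring

theorem IsClassTransposition.mul_pow_twelve_eq_one_of_le
    {n m r₁ r₂ r₃ r₄ : ℤ} (hnm : n ≤ m)
    (h₁ : 0 ≤ r₁) (h₂ : r₁ < r₂) (h₃ : r₂ < n) (h₄ : 0 ≤ r₃) (h₅ : r₃ < r₄) (h₆ : r₄ < m)
    {σ η : Equiv.Perm ℤ}
    (hσ : IsClassTransposition σ r₁ n r₂ n) (hη : IsClassTransposition η r₃ m r₄ m) :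
    (σ * η) ^ 12 = 1 := by
  have hs := hσ.apply_apply
  have ht := hη.apply_apply
  refine Equiv.Perm.mul_pow_twelve_eq_one hs ht fun y e1 e2 e3 e4 => ?_
  rw [← Equiv.Perm.mul_pow_apply_left_iff hs ht]
  generalize hx : σ y = x at *
  have e1' : σ x ≠ x := by
    rw [← hx, hs]
    exact Ne.symm (hx ▸ e1)
  clear hx e1
  have not_dvd {c : ℤ} (h0 : c ≠ 0) (hl : -m < c) (hu : c < m) : ¬ m ∣ c := fun h =>
    h0 (Int.eq_zero_of_abs_lt_dvd h (abs_lt.mpr ⟨hl, hu⟩))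
  have not_dvd' {c : ℤ} (h0 : c ≠ m) (hl : 0 < c) (hu : c < 2 * m) : ¬ m ∣ c := fun h =>
    h0 (Int.eq_of_dvd_of_pos_of_lt_two_mul h hl hu)
  -- an orbit with a doubled edge
  have double (h : σ (η x) = x) : ((σ * η) ^ 12) x = x := by
    simp [pow_succ, h]
  -- a path with six vertices
  have six (h0 : η (σ x) = σ x) (h5 : η (σ (η (σ (η x)))) = σ (η (σ (η x)))) :
      ((σ * η) ^ 12) x = x := by
    simp [pow_succ, h0, h5, hs, ht]
  rcases hη.dvd_of_apply_ne e2 with d2 | d2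
  · have E2 := hη.apply_of_dvd_left d2
    rw [E2] at e3 e4
    rcases hσ.dvd_of_apply_ne e3 with d3 | d3
    · have E3 := hσ.apply_of_dvd_left d3
      rw [E3] at e4
      rcases hη.dvd_of_apply_ne e4 with d4 | d4
      · have hm : (r₂ - r₁) + (r₄ - r₃) = m := by
          refine Int.eq_of_dvd_of_pos_of_lt_two_mul ?_ (by linarith) (by linarith)
          convert Int.dvd_sub d4 d2 using 1
          ring
        rcases hσ.dvd_of_apply_ne e1' with d1 | d1
        · have hb : n ∣ r₄ - r₃ := by
            convert Int.dvd_sub d3 d1 using 1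
            ring
          have hb' := Int.le_of_dvd (by linarith) hb
          have E1 := hσ.apply_of_dvd_left d1
          have E4 := hη.apply_of_dvd_left d4
          have E5 := hσ.apply_of_dvd_right (x := x + (r₄ - r₃) + (r₂ - r₁) + (r₄ - r₃)) (by
            convert Int.dvd_add d3 hb using 1
            ring)
          apply six
          · rw [E1]
            apply hη.apply_of_not_dvd
            · intro h
              refine not_dvd (c := r₂ - r₁) (by omega) (by omega) (by omega) ?_
              convert Int.dvd_sub h d2 using 1
              ring
            · intro h
              refine not_dvd (c := (r₂ - r₁) - (r₄ - r₃)) (by omega) (by omega) (by omega) ?_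
              convert Int.dvd_sub h d2 using 1
              ring
          · rw [E2, E3, E4, E5]
            apply hη.apply_of_not_dvd
            · intro h
              refine not_dvd' (c := 2 * (r₄ - r₃)) (by omega) (by omega) (by omega) ?_
              convert Int.dvd_sub h d2 using 1
              ring
            · intro h
              refine not_dvd (c := r₄ - r₃) (by omega) (by omega) (by omega) ?_
              convert Int.dvd_sub h d2 using 1
              ring
        · exfalso
          have hn : n ∣ m := by
            convert Int.dvd_sub d3 d1 using 1
            linarith
          have hd : n ∣ r₂ - r₃ := by
            convert Int.dvd_sub (hn.trans d2) d1 using 1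
            ring
          exact absurd (Int.eq_zero_of_abs_lt_dvd hd (abs_lt.mpr ⟨by omega, by omega⟩)) (by omega)
      · exfalso
        refine not_dvd (c := r₂ - r₁) (by omega) (by omega) (by omega) ?_
        convert Int.dvd_sub d4 d2 using 1
        ring
    · have E3 := hσ.apply_of_dvd_right d3
      rw [E3] at e4
      rcases hη.dvd_of_apply_ne e4 with d4 | d4
      · apply double
        by_contra hne
        rw [E2, E3] at hne
        refine not_dvd (c := (r₄ - r₃) - (r₂ - r₁)) (by omega) (by omega) (by omega) ?_
        convert Int.dvd_sub d4 d2 using 1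
        ring
      · exfalso
        refine not_dvd (c := -(r₂ - r₁)) (by omega) (by omega) (by omega) ?_
        convert Int.dvd_sub d4 d2 using 1
        ring
  · have E2 := hη.apply_of_dvd_right d2
    rw [E2] at e3 e4
    rcases hσ.dvd_of_apply_ne e3 with d3 | d3
    · have E3 := hσ.apply_of_dvd_left d3
      rw [E3] at e4
      rcases hη.dvd_of_apply_ne e4 with d4 | d4
      · exfalso
        refine not_dvd (c := r₂ - r₁) (by omega) (by omega) (by omega) ?_
        convert Int.dvd_sub d4 d2 using 1
        ring
      · apply double
        by_contra hne
        rw [E2, E3] at hne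
        refine not_dvd (c := (r₂ - r₁) - (r₄ - r₃)) (by omega) (by omega) (by omega) ?_
        convert Int.dvd_sub d4 d2 using 1
        ring
    · have E3 := hσ.apply_of_dvd_right d3
      rw [E3] at e4
      rcases hη.dvd_of_apply_ne e4 with d4 | d4
      · exfalso
        refine not_dvd (c := -(r₂ - r₁)) (by omega) (by omega) (by omega) ?_
        convert Int.dvd_sub d4 d2 using 1
        ring
      · have hm : (r₂ - r₁) + (r₄ - r₃) = m := by
          refine Int.eq_of_dvd_of_pos_of_lt_two_mul ?_ (by linarith) (by linarith)
          convert Int.dvd_sub d2 d4 using 1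
          ring
        rcases hσ.dvd_of_apply_ne e1' with d1 | d1
        · exfalso
          have hn : n ∣ m := by
            convert Int.dvd_sub d1 d3 using 1
            linarith
          have hd : n ∣ r₂ - r₃ := by
            convert Int.dvd_add (Int.dvd_sub (hn.trans d2) d1) hn using 1
            linarith
          exact absurd (Int.eq_zero_of_abs_lt_dvd hd (abs_lt.mpr ⟨by omega, by omega⟩)) (by omega)
        · have hb : n ∣ r₄ - r₃ := by
            convert Int.dvd_sub d1 d3 using 1
            ring
          have hb' := Int.le_of_dvd (by linarith) hb
          have E1 := hσ.apply_of_dvd_right d1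
          have E4 := hη.apply_of_dvd_right d4
          have E5 := hσ.apply_of_dvd_left (x := x - (r₄ - r₃) - (r₂ - r₁) - (r₄ - r₃)) (by
            convert Int.dvd_sub d3 hb using 1
            ring)
          apply six
          · rw [E1]
            apply hη.apply_of_not_dvd
            · intro h
              refine not_dvd (c := (r₄ - r₃) - (r₂ - r₁)) (by omega) (by omega) (by omega) ?_
              convert Int.dvd_sub h d2 using 1
              ring
            · intro h
              refine not_dvd (c := r₂ - r₁) (by omega) (by omega) (by omega) ?_
              convert Int.dvd_sub d2 h using 1
              ring
          · rw [E2, E3, E4, E5]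
            apply hη.apply_of_not_dvd
            · intro h
              refine not_dvd (c := r₄ - r₃) (by omega) (by omega) (by omega) ?_
              convert Int.dvd_sub d2 h using 1
              ring
            · intro h
              refine not_dvd' (c := 2 * (r₄ - r₃)) (by omega) (by omega) (by omega) ?_
              convert Int.dvd_sub d2 h using 1
              ring

/-- For horizontal class transpositions `σ = τ_{r₁(n),r₂(n)}` and
`η = τ_{r₃(m),r₄(m)}` with `0 ≤ r₁ < r₂ < n` and `0 ≤ r₃ < r₄ < m`, the permutation
`(σ · η)¹²` is the identity permutation of `ℤ`. -/
theorem prod_two_horizontal_pow_twelve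
    (n m r₁ r₂ r₃ r₄ : ℤ)
    (h₁ : 0 ≤ r₁) (h₂ : r₁ < r₂) (h₃ : r₂ < n)
    (h₄ : 0 ≤ r₃) (h₅ : r₃ < r₄) (h₆ : r₄ < m)
    (σ η : Equiv.Perm ℤ)
    (hσ : IsClassTransposition σ r₁ n r₂ n)
    (hη : IsClassTransposition η r₃ m r₄ m) :
    (σ * η) ^ 12 = 1 := by
  rcases le_total n m with hnm | hnm
  · exact hσ.mul_pow_twelve_eq_one_of_le hnm h₁ h₂ h₃ h₄ h₅ h₆ hη
  · have hs : σ⁻¹ = σ := inv_eq_of_mul_eq_one_right (Equiv.ext hσ.apply_apply)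
    have ht : η⁻¹ = η := inv_eq_of_mul_eq_one_right (Equiv.ext hη.apply_apply)
    have h := hη.mul_pow_twelve_eq_one_of_le hnm h₄ h₅ h₆ h₁ h₂ h₃ hσ
    rw [← inv_inj, ← inv_pow, mul_inv_rev, hs, ht, h, inv_one]
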